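/- Let G = ⊕_{i∈ℕ} ℤ be the direct sum of countably many copies of ℤ (finitely supported integer sequences), and define q : G → ℂ by q(x) = ∑_i x_i². Then: (a) (Δ_{y₁,y₂,y₃} q)(x) = 0 for all x, y₁, y₂, y₃ ∈ G; (b) for every y ∈ G the additive function x ↦ ∑_i x_i·y_i belongs to the smallest translation-invariant ℂ-linear subspace of ℂ^G containing q that is closed in the product (pointwise convergence) topology; and (c) this closed translation-invariant subspace generated by q is infinite-dimensional, so q lies in no finite-dimensional translation-invariant subspace of ℂ^G. -/

import Mathlib

/-- The plain difference operator: `(Δ_y f)(x) = f(x+y) − f(x)`. -/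
def plainDiff {G : Type*} [AddCommGroup G] (y : G) (f : G → ℂ) : G → ℂ :=
  fun x => f (x + y) - f x

/-- The quadratic function `q(x) = ∑ᵢ xᵢ²` on `G = ⊕_{i∈ℕ} ℤ`
(finitely supported integer sequences). -/
noncomputable def qFun : (ℕ →₀ ℤ) → ℂ :=
  fun x => x.sum fun _ v => (v : ℂ) ^ 2

/-- The variety of `f`: the smallest translation-invariant `ℂ`-linear subspace
of `ℂ^G` containing `f` that is closed in the product (pointwise convergence)
topology. -/
noncomputable def varietyOf (f : (ℕ →₀ ℤ) → ℂ) : Submodule ℂ ((ℕ →₀ ℤ) → ℂ) :=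
  sInf {V : Submodule ℂ ((ℕ →₀ ℤ) → ℂ) |
    IsClosed (V : Set ((ℕ →₀ ℤ) → ℂ)) ∧
    (∀ h ∈ V, ∀ g : ℕ →₀ ℤ, (fun x => h (x + g)) ∈ V) ∧ f ∈ V}

/-- The standard pairing `⟨x, y⟩ = ∑ᵢ xᵢ yᵢ` on `⊕_{i∈ℕ} ℤ`, with values in `ℂ`. -/
noncomputable def pairing (x y : ℕ →₀ ℤ) : ℂ :=
  x.sum fun i xi => (xi : ℂ) * (y i : ℂ)

theorem pairing_add_left (x x' y : ℕ →₀ ℤ) :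
    pairing (x + x') y = pairing x y + pairing x' y :=
  Finsupp.sum_add_index' (by simp) fun i a b => by push_cast; ring

theorem qFun_add (x y : ℕ →₀ ℤ) : qFun (x + y) = qFun x + qFun y + 2 * pairing x y := by
  have hx : x.support ⊆ x.support ∪ y.support := Finset.subset_union_left
  have hy : y.support ⊆ x.support ∪ y.support := Finset.subset_union_right
  unfold qFun pairing
  rw [Finsupp.sum_of_support_subset _ Finsupp.support_add _ (by simp),
    Finsupp.sum_of_support_subset _ hx _ (by simp),
    Finsupp.sum_of_support_subset _ hy _ (by simp),
    Finsupp.sum_of_support_subset _ hx _ (by simp),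
    Finset.mul_sum, ← Finset.sum_add_distrib, ← Finset.sum_add_distrib]
  refine Finset.sum_congr rfl fun i _ => ?_
  rw [Finsupp.add_apply]
  push_cast
  ring

theorem pairing_neg_right (x y : ℕ →₀ ℤ) : pairing x (-y) = -pairing x y := by
  simp [pairing, Finsupp.sum]

theorem qFun_neg (y : ℕ →₀ ℤ) : qFun (-y) = qFun y := by
  simp [qFun, Finsupp.sum]

/-- Polarization: `4⟨x, y⟩ = q(x + y) - q(x - y)`, so the pairing with `y` is a combination of two
translates of `q`. -/
theorem pairing_mem_of_translationInvariant {V : Submodule ℂ ((ℕ →₀ ℤ) → ℂ)}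
    (hV : ∀ h ∈ V, ∀ g : ℕ →₀ ℤ, (fun x => h (x + g)) ∈ V) (hq : qFun ∈ V) (y : ℕ →₀ ℤ) :
    (fun x => pairing x y) ∈ V := by
  have h := V.smul_mem (1 / 4 : ℂ) (V.sub_mem (hV _ hq y) (hV _ hq (-y)))
  convert h using 1
  funext x
  simp only [Pi.smul_apply, Pi.sub_apply, smul_eq_mul, qFun_add, pairing_neg_right, qFun_neg]
  ring

theorem linearIndependent_pairing_single :
    LinearIndependent ℂ fun (i : ℕ) (x : ℕ →₀ ℤ) => pairing x (Finsupp.single i 1) := by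
  rw [linearIndependent_iff']
  intro s c hc j hj
  have h := congrFun hc (Finsupp.single j 1)
  simpa [pairing, Finsupp.single_apply, hj] using h

theorem not_finiteDimensional_of_qFun_mem {V : Submodule ℂ ((ℕ →₀ ℤ) → ℂ)}
    (hV : ∀ h ∈ V, ∀ g : ℕ →₀ ℤ, (fun x => h (x + g)) ∈ V) (hq : qFun ∈ V) :
    ¬ FiniteDimensional ℂ V := by
  intro hfin
  have hli : LinearIndependent ℂ fun i : ℕ =>
      (⟨_, pairing_mem_of_translationInvariant hV hq (Finsupp.single i 1)⟩ : V) :=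
    LinearIndependent.of_comp V.subtype linearIndependent_pairing_single
  exact not_finite_iff_infinite.mpr (inferInstanceAs (Infinite ℕ)) hli.finite

theorem varietyOf_translate_mem (f : (ℕ →₀ ℤ) → ℂ) :
    ∀ h ∈ varietyOf f, ∀ g : ℕ →₀ ℤ, (fun x => h (x + g)) ∈ varietyOf f := by
  intro h hh g
  rw [varietyOf, Submodule.mem_sInf] at hh ⊢
  exact fun V hV => hV.2.1 h (hh V hV) g

theorem mem_varietyOf (f : (ℕ →₀ ℤ) → ℂ) : f ∈ varietyOf f :=
  Submodule.mem_sInf.mpr fun _ hV => hV.2.2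

/-- on `G = ⊕_{i∈ℕ} ℤ` with `q(x) = ∑ᵢ xᵢ²`:
(a) all third differences of `q` vanish;
(b) for each `y ∈ G` the additive function `x ↦ ∑ᵢ xᵢ·yᵢ` belongs to the
variety of `q`;
(c) this variety is infinite-dimensional, and `q` lies in no
finite-dimensional translation-invariant subspace of `ℂ^G`. -/
theorem quadratic_on_direct_sum :
    (∀ x y₁ y₂ y₃ : ℕ →₀ ℤ,
      plainDiff y₁ (plainDiff y₂ (plainDiff y₃ qFun)) x = 0) ∧
    (∀ y : ℕ →₀ ℤ,
      (fun x : ℕ →₀ ℤ => x.sum fun i xi => (xi : ℂ) * (y i : ℂ)) ∈ varietyOf qFun) ∧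
    (¬ FiniteDimensional ℂ (varietyOf qFun)) ∧
    ¬ ∃ W : Submodule ℂ ((ℕ →₀ ℤ) → ℂ), FiniteDimensional ℂ W ∧
        (∀ h ∈ W, ∀ g : ℕ →₀ ℤ, (fun x => h (x + g)) ∈ W) ∧ qFun ∈ W := by
  refine ⟨fun x y₁ y₂ y₃ => ?_,
    pairing_mem_of_translationInvariant (varietyOf_translate_mem _) (mem_varietyOf _),
    not_finiteDimensional_of_qFun_mem (varietyOf_translate_mem _) (mem_varietyOf _),
    fun ⟨_, hfin, hW, hq⟩ => not_finiteDimensional_of_qFun_mem hW hq hfin⟩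
  simp only [plainDiff, qFun_add, pairing_add_left]
  ring
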